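/- Let n ≥ 1. On the open set {(x,y) ∈ ℝ^n × ℝ^n : x + y ≠ 0}, let ϖ(x,y) = √2/‖x+y‖, let ν denote the unit vector of ℝ^{2n} with components a_i = −(x_i+y_i)/(√2‖x+y‖) in the x_i slots and b_i = (x_i+y_i)/(√2‖x+y‖) in the y_i slots, and let ν° denote the vector with components c_i = −(x_i+y_i)/(√2‖x+y‖) in both the x_i and the y_i slots. Then at every point p of this set: Δϖ(p) − (Hess ϖ(p))(ν(p), ν(p)) − ϖ(p)·⟨∇ϖ(p), ν°(p)⟩ = −(2(n−2)/‖x+y‖²)·ϖ(p), where Δ, Hess and ∇ are the Euclidean Laplacian, Hessian and gradient on ℝ^{2n}. -/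

import Mathlib

open scoped RealInnerProductSpace

noncomputable section

/-- `‖x + y‖` on `ℝ^{2n}`, where the `x` slots are indexed by `Sum.inl` and the
`y` slots by `Sum.inr`. -/
def sNorm (n : ℕ) (p : EuclideanSpace ℝ (Fin n ⊕ Fin n)) : ℝ :=
  Real.sqrt (∑ i : Fin n, (p (Sum.inl i) + p (Sum.inr i)) ^ 2)

/-- The normalized vertical component `ϖ = √2/‖x+y‖` of the normal of the
hyperbolic paraboloid, as a function on `ℝ^{2n}`. -/
def varpi (n : ℕ) (p : EuclideanSpace ℝ (Fin n ⊕ Fin n)) : ℝ :=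
  Real.sqrt 2 / sNorm n p

/-- The unit horizontal normal `ν` of the hyperbolic paraboloid, with
components `a_i = -(x_i+y_i)/(√2‖x+y‖)` in the `x_i` slots and
`b_i = (x_i+y_i)/(√2‖x+y‖)` in the `y_i` slots. -/
def nuVec (n : ℕ) (p : EuclideanSpace ℝ (Fin n ⊕ Fin n)) :
    EuclideanSpace ℝ (Fin n ⊕ Fin n) :=
  (EuclideanSpace.equiv (Fin n ⊕ Fin n) ℝ).symm
    (Sum.elim
      (fun i => -(p (Sum.inl i) + p (Sum.inr i)) / (Real.sqrt 2 * sNorm n p))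
      (fun i => (p (Sum.inl i) + p (Sum.inr i)) / (Real.sqrt 2 * sNorm n p)))

/-- The vector `ν° = -C_H^{2n+1}ν`, with components
`c_i = -(x_i+y_i)/(√2‖x+y‖)` in both the `x_i` and the `y_i` slots. -/
def nuCirc (n : ℕ) (p : EuclideanSpace ℝ (Fin n ⊕ Fin n)) :
    EuclideanSpace ℝ (Fin n ⊕ Fin n) :=
  (EuclideanSpace.equiv (Fin n ⊕ Fin n) ℝ).symm
    (Sum.elim
      (fun i => -(p (Sum.inl i) + p (Sum.inr i)) / (Real.sqrt 2 * sNorm n p))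
      (fun i => -(p (Sum.inl i) + p (Sum.inr i)) / (Real.sqrt 2 * sNorm n p)))

/-- The Euclidean Laplacian on `ℝ^{2n}`, as the sum of the pure second
derivatives along the standard basis directions. -/
def lap2 (n : ℕ) (f : EuclideanSpace ℝ (Fin n ⊕ Fin n) → ℝ)
    (p : EuclideanSpace ℝ (Fin n ⊕ Fin n)) : ℝ :=
  ∑ k : Fin n ⊕ Fin n,
    fderiv ℝ (fun y => fderiv ℝ f y (EuclideanSpace.single k 1)) p
      (EuclideanSpace.single k 1)

/-- The Euclidean Hessian of `f` at `p`, evaluated on the pair `(u, v)`. -/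
def hess (n : ℕ) (f : EuclideanSpace ℝ (Fin n ⊕ Fin n) → ℝ)
    (p u v : EuclideanSpace ℝ (Fin n ⊕ Fin n)) : ℝ :=
  fderiv ℝ (fun y => fderiv ℝ f y u) p v

section InverseNorm

variable {E F : Type*} [NormedAddCommGroup E] [InnerProductSpace ℝ E]
  [NormedAddCommGroup F] [InnerProductSpace ℝ F]

theorem hasFDerivAt_inv_norm {z : F} (hz : z ≠ 0) :
    HasFDerivAt (fun w : F => ‖w‖⁻¹) (-(‖z‖⁻¹ ^ 3) • innerSL ℝ z) z := by
  have hz' : ‖z‖ ≠ 0 := norm_ne_zero_iff.mpr hz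
  have h := (hasDerivAt_inv (by simpa using hz')).comp_hasFDerivAt z
    ((hasStrictFDerivAt_norm_sq z).hasFDerivAt.sqrt (pow_ne_zero 2 hz'))
  simp only [Function.comp_def, Real.sqrt_sq (norm_nonneg _)] at h
  refine h.congr_fderiv ?_
  ext v
  simp
  field_simp

theorem hasFDerivAt_inv_norm_comp (A : E →L[ℝ] F) {p : E} (hp : A p ≠ 0) :
    HasFDerivAt (fun q => ‖A q‖⁻¹) (-(‖A p‖⁻¹ ^ 3) • (innerSL ℝ (A p)).comp A) p :=
  (hasFDerivAt_inv_norm hp).comp p A.hasFDerivAt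

theorem fderiv_inv_norm_comp_apply (A : E →L[ℝ] F) {p : E} (hp : A p ≠ 0) (u : E) :
    fderiv ℝ (fun q => ‖A q‖⁻¹) p u = -(‖A p‖⁻¹ ^ 3) * ⟪A p, A u⟫ := by
  simp [(hasFDerivAt_inv_norm_comp A hp).fderiv]

theorem fderiv_fderiv_inv_norm_comp_apply (A : E →L[ℝ] F) {p : E} (hp : A p ≠ 0) (u v : E) :
    fderiv ℝ (fun q => fderiv ℝ (fun q => ‖A q‖⁻¹) q u) p v
      = 3 * ‖A p‖⁻¹ ^ 5 * ⟪A p, A u⟫ * ⟪A p, A v⟫ - ‖A p‖⁻¹ ^ 3 * ⟪A v, A u⟫ := by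
  have hev : (fun q => fderiv ℝ (fun q => ‖A q‖⁻¹) q u)
      =ᶠ[nhds p] fun q => -(‖A q‖⁻¹ ^ 3 * ⟪A u, A q⟫) := by
    filter_upwards [A.continuous.continuousAt.eventually_ne hp] with q hq
    rw [fderiv_inv_norm_comp_apply A hq, real_inner_comm]
    ring
  have h := (((hasFDerivAt_inv_norm_comp A hp).pow 3).mul
    ((innerSL ℝ (A u)).comp A).hasFDerivAt).neg
  have h' : HasFDerivAt (fun q => -(‖A q‖⁻¹ ^ 3 * ⟪A u, A q⟫)) _ p := h
  rw [hev.fderiv_eq, h'.fderiv]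
  simp [real_inner_comm (A u)]
  ring

end InverseNorm

/-- The linear map `(x, y) ↦ x + y`. -/
def addHalves (n : ℕ) : EuclideanSpace ℝ (Fin n ⊕ Fin n) →L[ℝ] EuclideanSpace ℝ (Fin n) :=
  LinearMap.toContinuousLinearMap
    { toFun := fun p => WithLp.toLp 2 fun i => p (Sum.inl i) + p (Sum.inr i)
      map_add' := fun p q => by
        ext i
        simp
        ring
      map_smul' := fun c p => by
        ext i
        simp
        ring }

@[simp]
theorem addHalves_apply (n : ℕ) (p : EuclideanSpace ℝ (Fin n ⊕ Fin n)) (i : Fin n) :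
    addHalves n p i = p (Sum.inl i) + p (Sum.inr i) :=
  rfl

@[simp]
theorem addHalves_single_inl (n : ℕ) (i : Fin n) :
    addHalves n (EuclideanSpace.single (Sum.inl i) 1) = EuclideanSpace.single i 1 := by
  ext j
  simp

@[simp]
theorem addHalves_single_inr (n : ℕ) (i : Fin n) :
    addHalves n (EuclideanSpace.single (Sum.inr i) 1) = EuclideanSpace.single i 1 := by
  ext j
  simp

theorem sNorm_eq_norm_addHalves (n : ℕ) (p : EuclideanSpace ℝ (Fin n ⊕ Fin n)) :
    sNorm n p = ‖addHalves n p‖ := by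
  simp [sNorm, EuclideanSpace.norm_eq]

theorem addHalves_nuVec (n : ℕ) (p : EuclideanSpace ℝ (Fin n ⊕ Fin n)) :
    addHalves n (nuVec n p) = 0 := by
  ext i
  simp [nuVec]
  ring

theorem addHalves_nuCirc (n : ℕ) (p : EuclideanSpace ℝ (Fin n ⊕ Fin n)) :
    addHalves n (nuCirc n p) = (-(2 / (√2 * ‖addHalves n p‖))) • addHalves n p := by
  ext i
  simp [nuCirc, sNorm_eq_norm_addHalves]
  ring

theorem varpi_eq (n : ℕ) : varpi n = √2 • fun p => ‖addHalves n p‖⁻¹ := by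
  ext p
  rw [varpi, sNorm_eq_norm_addHalves, div_eq_mul_inv]
  rfl

theorem fderiv_varpi_apply (n : ℕ) {p : EuclideanSpace ℝ (Fin n ⊕ Fin n)}
    (hp : addHalves n p ≠ 0) (u : EuclideanSpace ℝ (Fin n ⊕ Fin n)) :
    fderiv ℝ (varpi n) p u
      = -√2 * ‖addHalves n p‖⁻¹ ^ 3 * ⟪addHalves n p, addHalves n u⟫ := by
  rw [varpi_eq, fderiv_const_smul_field, Pi.smul_apply, smul_apply, fderiv_inv_norm_comp_apply _ hp, smul_eq_mul]
  ring

theorem hess_varpi (n : ℕ) {p : EuclideanSpace ℝ (Fin n ⊕ Fin n)}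
    (hp : addHalves n p ≠ 0) (u v : EuclideanSpace ℝ (Fin n ⊕ Fin n)) :
    hess n (varpi n) p u v
      = √2 * (3 * ‖addHalves n p‖⁻¹ ^ 5 * ⟪addHalves n p, addHalves n u⟫
          * ⟪addHalves n p, addHalves n v⟫
        - ‖addHalves n p‖⁻¹ ^ 3 * ⟪addHalves n v, addHalves n u⟫) := by
  have h : (fun q => fderiv ℝ (varpi n) q u)
      = √2 • fun q => fderiv ℝ (fun q => ‖addHalves n q‖⁻¹) q u := by
    rw [varpi_eq, fderiv_const_smul_field]
    rfl
  rw [hess, h, fderiv_const_smul_field, Pi.smul_apply, smul_apply,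
    fderiv_fderiv_inv_norm_comp_apply _ hp, smul_eq_mul]

theorem lap2_varpi (n : ℕ) {p : EuclideanSpace ℝ (Fin n ⊕ Fin n)} (hp : addHalves n p ≠ 0) :
    lap2 n (varpi n) p = 2 * √2 * (3 - n) * ‖addHalves n p‖⁻¹ ^ 3 := by
  have hsum : lap2 n (varpi n) p = ∑ k : Fin n ⊕ Fin n,
      hess n (varpi n) p (EuclideanSpace.single k 1) (EuclideanSpace.single k 1) := rfl
  have hterm {k : Fin n ⊕ Fin n} {i : Fin n}
      (hk : addHalves n (EuclideanSpace.single k 1) = EuclideanSpace.single i 1) :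
      hess n (varpi n) p (EuclideanSpace.single k 1) (EuclideanSpace.single k 1)
        = 3 * √2 * ‖addHalves n p‖⁻¹ ^ 5 * addHalves n p i ^ 2
          - √2 * ‖addHalves n p‖⁻¹ ^ 3 := by
    rw [hess_varpi n hp, hk, real_inner_self_eq_norm_sq, EuclideanSpace.inner_single_right]
    simp only [PiLp.norm_single, norm_one, conj_trivial]
    ring
  have hr : ‖addHalves n p‖ ≠ 0 := norm_ne_zero_iff.mpr hp
  simp only [hsum, Fintype.sum_sum_type, hterm (addHalves_single_inl n _),
    hterm (addHalves_single_inr n _), Finset.sum_sub_distrib, ← Finset.mul_sum,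
    ← EuclideanSpace.real_norm_sq_eq, Finset.sum_const, Finset.card_univ, Fintype.card_fin,
    nsmul_eq_mul]
  field_simp
  ring

/-- On the hyperbolic paraboloid in `ℍⁿ` (an H-minimal hypersurface), away from
the characteristic set one has
`Δϖ - Hess ϖ(ν, ν) - ϖ·⟨∇ϖ, ν°⟩ = -(2(n-2)/‖x+y‖²)·ϖ`,
which is the identity `ℒ_HS ϖ + ϖ·𝓑_TS = 0` of Lemma 5.4 for this surface. -/
theorem LHS_varpi_hyperbolic_paraboloid
    (n : ℕ) (hn : 1 ≤ n) (p : EuclideanSpace ℝ (Fin n ⊕ Fin n))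
    (hp : ∃ i : Fin n, p (Sum.inl i) + p (Sum.inr i) ≠ 0) :
    lap2 n (varpi n) p - hess n (varpi n) p (nuVec n p) (nuVec n p)
        - varpi n p * ⟪gradient (varpi n) p, nuCirc n p⟫
      = -(2 * ((n : ℝ) - 2) / (sNorm n p) ^ 2) * varpi n p := by
  have hz : addHalves n p ≠ 0 := by
    obtain ⟨i, hi⟩ := hp
    exact fun h => hi (by simpa using congrArg (fun w => w i) h)
  have hr : ‖addHalves n p‖ ≠ 0 := norm_ne_zero_iff.mpr hz
  have hgrad : ⟪gradient (varpi n) p, nuCirc n p⟫ = 2 * ‖addHalves n p‖⁻¹ ^ 2 := by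
    rw [gradient, InnerProductSpace.toDual_symm_apply, fderiv_varpi_apply n hz,
      addHalves_nuCirc, real_inner_smul_right, real_inner_self_eq_norm_sq]
    field_simp
  rw [hgrad, lap2_varpi n hz, hess_varpi n hz, addHalves_nuVec, sNorm_eq_norm_addHalves,
    varpi_eq]
  simp only [inner_zero_right, Pi.smul_apply, smul_eq_mul]
  field_simp
  ring

end
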